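/- arXiv:2605.21655 — 2 statements merged into one kernel-verified Lean document; each statement's English description precedes it below -/
import Mathlib

section
/- Let A be a unital, simple, infinite-dimensional C*-algebra with T(A) ≠ ∅. Let X₁ := {τ ↦ τ(e) : e ∈ A positive}, and let Σ(X₁) be the set of functions h : T(A) → [0,∞] of the form h(τ) = ∑_{n=1}^∞ h_n(τ) (pointwise) with each h_n ∈ X₁. Assume that for every positive a ∈ A, every ε > 0, and every f ∈ Σ(X₁) with f(τ) < d_τ(a) for all τ ∈ T(A), there exists a positive b ∈ A with b ≲ a and |f(τ) − d_τ(b)| < ε for all τ ∈ T(A). Then every positive element of A has tracial approximate oscillation zero. -/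
open scoped ComplexOrder

/-- A tracial state on a C*-algebra: a positive linear functional of norm one which is
tracial (`τ(xy) = τ(yx)`). -/
def IsTracialState {A : Type*} [NonUnitalNormedRing A] [StarRing A] [NormedSpace ℂ A]
    (τ : A →L[ℂ] ℂ) : Prop :=
  (∀ x : A, 0 ≤ τ (star x * x)) ∧ ‖τ‖ = 1 ∧ ∀ x y : A, τ (x * y) = τ (y * x)

/-- The set `T(A)` of tracial states of `A`. -/
def traceSet (A : Type*) [CStarAlgebra A] : Set (A →L[ℂ] ℂ) := {τ | IsTracialState τ}

/-- The function `f_ε : ℝ → [0,1]`: `0` on `(-∞, ε]`, `1` on `[2ε, ∞)`, linear on `[ε, 2ε]`. -/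
noncomputable def fE (ε : ℝ) : ℝ → ℝ := fun t => min 1 (max 0 ((t - ε) / ε))

variable {A : Type*} [CStarAlgebra A]

/-- `d_τ(a) := sup_n τ(f_{1/n}(a))`. -/
noncomputable def dTau (τ : A →L[ℂ] ℂ) (a : A) : ℝ :=
  ⨆ n : ℕ, (τ (cfc (fE (1 / (n + 1 : ℝ))) a)).re

/-- The tracial oscillation `ω(a) = lim_n sup_{τ ∈ T(A)} (d_τ(a) − τ(f_{1/n}(a)))`; since the
sequence of suprema is nonincreasing, the limit is the infimum. -/
noncomputable def osc (a : A) : ℝ :=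
  ⨅ n : ℕ, ⨆ τ : ↥(traceSet A),
    (dTau (τ : A →L[ℂ] ℂ) a - ((τ : A →L[ℂ] ℂ) (cfc (fE (1 / (n + 1 : ℝ))) a)).re)

/-- The tracial 2-seminorm `‖x‖₂ = sup_{τ ∈ T(A)} τ(x*x)^{1/2}`. -/
noncomputable def norm2 (x : A) : ℝ :=
  ⨆ τ : ↥(traceSet A), Real.sqrt (((τ : A →L[ℂ] ℂ) (star x * x)).re)

/-- The hereditary C*-subalgebra generated by `a`, i.e. the norm closure of `aAa`. -/
def her (a : A) : Set A := closure {y : A | ∃ x : A, y = a * x * a}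

/-- An element `a` has tracial approximate oscillation zero if for every `ε > 0` there is a
positive `c ∈ Her(a)` with `‖c‖ ≤ ‖a‖`, `‖a − c‖₂ < ε` and `ω(c) < ε`. -/
def TAOZero [PartialOrder A] [StarOrderedRing A] (a : A) : Prop :=
  ∀ ε > 0, ∃ c ∈ her a, 0 ≤ c ∧ ‖c‖ ≤ ‖a‖ ∧ norm2 (a - c) < ε ∧ osc c < ε

/-- The weak-* topology on a set of continuous linear functionals: the topology induced from
the product topology on `A → ℂ` via pointwise evaluation. -/
noncomputable def wstar (S : Set (A →L[ℂ] ℂ)) : TopologicalSpace S :=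
  TopologicalSpace.induced (fun φ => ((φ : A →L[ℂ] ℂ) : A → ℂ)) Pi.topologicalSpace

/-- Continuity of a real-valued function on a set of functionals, for the weak-* topology. -/
def IsWstarContinuous {S : Set (A →L[ℂ] ℂ)} (h : S → ℝ) : Prop :=
  @Continuous _ _ (wstar S) _ h

/-- Affinity of a real-valued function on a (convex) set of functionals. -/
def IsAffineOn {S : Set (A →L[ℂ] ℂ)} (h : S → ℝ) : Prop :=
  ∀ (φ ψ : S) (t : ℝ), t ∈ Set.Icc (0 : ℝ) 1 →
    ∀ hmem : t • (φ : A →L[ℂ] ℂ) + (1 - t) • (ψ : A →L[ℂ] ℂ) ∈ S,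
      h ⟨_, hmem⟩ = t * h φ + (1 - t) * h ψ

/-- Cuntz subequivalence `a ≲ b`: there are `x_k` with `‖a − x_k* b x_k‖ → 0`. -/
def CuntzLe (a b : A) : Prop :=
  ∃ x : ℕ → A, Filter.Tendsto (fun k => ‖a - star (x k) * b * x k‖) Filter.atTop (nhds 0)

/-- `Σ(X)`: functions on `T(A)` which are pointwise sums of a sequence of members of `X`
(finite-valued case; the side conditions below only involve finite values). -/
def SigmaX (X : Set (↥(traceSet A) → ℝ)) : Set (↥(traceSet A) → ℝ) :=
  {h | ∃ g : ℕ → (↥(traceSet A) → ℝ), (∀ n, g n ∈ X) ∧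
    ∀ τ : ↥(traceSet A), HasSum (fun n => g n τ) (h τ)}

section TracialStates

/-- The real part of a functional, as a real-linear functional. -/
noncomputable def reTr (τ : A →L[ℂ] ℂ) : A →L[ℝ] ℝ :=
  Complex.reCLM.comp (τ.restrictScalars ℝ)

lemma reTr_apply (τ : A →L[ℂ] ℂ) (x : A) : reTr τ x = (τ x).re := rfl

lemma reTr_mul_comm {τ : A →L[ℂ] ℂ} (hτ : IsTracialState τ) (x y : A) :
    reTr τ (x * y) = reTr τ (y * x) := by
  simp only [reTr_apply, hτ.2.2 x y]

lemma abs_reTr_le {τ : A →L[ℂ] ℂ} (hτ : IsTracialState τ) (x : A) : |reTr τ x| ≤ ‖x‖ := by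
  calc |reTr τ x| ≤ ‖τ x‖ := Complex.abs_re_le_norm _
    _ ≤ ‖τ‖ * ‖x‖ := τ.le_opNorm x
    _ = ‖x‖ := by rw [hτ.2.1, one_mul]

/-- `τ((x*x) ψ(x*x)) = τ((xx*) ψ(xx*))` for a trace `τ`. -/
lemma reTr_mul_cfc_star_mul_self [Nontrivial A] {τ : A →L[ℂ] ℂ} (hτ : IsTracialState τ) (x : A)
    {ψ : ℝ → ℝ}
    (hψ : Continuous ψ) :
    reTr τ (star x * x * cfc ψ (star x * x)) = reTr τ (x * star x * cfc ψ (x * star x)) := by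
  have hpoly : ∀ P : Polynomial ℝ,
      reTr τ (star x * x * Polynomial.aeval (star x * x) P) =
        reTr τ (x * star x * Polynomial.aeval (x * star x) P) := by
    intro P
    induction P using Polynomial.induction_on' with
    | add p q hp hq => simp only [map_add, mul_add, hp, hq]
    | monomial n c =>
      have h (n : ℕ) : (star x * x) ^ n * star x = star x * (x * star x) ^ n := by
        induction n with
        | zero => simp
        | succ n ih => rw [pow_succ', mul_assoc, ih, pow_succ']; simp only [mul_assoc]
      have : reTr τ (star x * x * (star x * x) ^ n) = reTr τ (x * star x * (x * star x) ^ n) := by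
        rw [← pow_succ', pow_succ, ← mul_assoc, h, reTr_mul_comm hτ, mul_assoc]
      simp only [Polynomial.aeval_monomial, ← Algebra.smul_def, mul_smul_comm, map_smul, this]
  have hnorm : ∀ y : A, IsSelfAdjoint y → ‖y‖ ≤ ‖x‖ * ‖x‖ → ∀ (P : Polynomial ℝ) (δ : ℝ), 0 < δ →
      (∀ t ∈ Set.Icc (-(‖x‖ * ‖x‖)) (‖x‖ * ‖x‖), |P.eval t - ψ t| < δ) →
      |reTr τ (y * Polynomial.aeval y P) - reTr τ (y * cfc ψ y)| ≤ ‖x‖ * ‖x‖ * δ := by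
    intro y hy hyx P δ hδ hP
    rw [← map_sub, ← mul_sub]
    refine (abs_reTr_le hτ _).trans ((norm_mul_le _ _).trans ?_)
    gcongr
    rw [← cfc_polynomial (R := ℝ) P y hy, ← cfc_sub (fun t => P.eval t) ψ y]
    refine norm_cfc_le hδ.le fun t ht => ?_
    refine (hP t ?_).le
    have := (spectrum.norm_le_norm_of_mem ht).trans hyx
    exact abs_le.mp this
  have hs1 : ‖star x * x‖ ≤ ‖x‖ * ‖x‖ := (CStarRing.norm_star_mul_self).le
  have hs2 : ‖x * star x‖ ≤ ‖x‖ * ‖x‖ := (CStarRing.norm_self_mul_star).le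
  refine eq_of_forall_dist_le fun ε hε => ?_
  set M := ‖x‖ * ‖x‖ with hM
  have hM0 : 0 ≤ M := by positivity
  have hδ : 0 < ε / (2 * (M + 1)) := by positivity
  obtain ⟨P, hP⟩ := exists_polynomial_near_of_continuousOn (-M) M ψ hψ.continuousOn _ hδ
  have h1 := hnorm _ (IsSelfAdjoint.star_mul_self x) hs1 P _ hδ hP
  have h2 := hnorm _ (IsSelfAdjoint.mul_star_self x) hs2 P _ hδ hP
  rw [hpoly] at h1
  have h3 : M * (ε / (2 * (M + 1))) ≤ ε / 2 := by
    rw [mul_div_assoc', div_le_div_iff₀ (by positivity) (by positivity)]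
    nlinarith
  rw [Real.dist_eq]
  rw [abs_le] at h1 h2 ⊢
  constructor <;> linarith [h1.1, h1.2, h2.1, h2.2]

variable [PartialOrder A] [StarOrderedRing A]

lemma nonneg_of_isTracialState {τ : A →L[ℂ] ℂ} (hτ : IsTracialState τ) {x : A} (hx : 0 ≤ x) :
    0 ≤ τ x := by
  obtain ⟨y, rfl⟩ := CStarAlgebra.nonneg_iff_eq_star_mul_self.mp hx
  exact hτ.1 y

lemma reTr_nonneg {τ : A →L[ℂ] ℂ} (hτ : IsTracialState τ) {x : A} (hx : 0 ≤ x) :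
    0 ≤ reTr τ x :=
  (Complex.le_def.mp (nonneg_of_isTracialState hτ hx)).1

lemma reTr_mono {τ : A →L[ℂ] ℂ} (hτ : IsTracialState τ) {x y : A} (hxy : x ≤ y) :
    reTr τ x ≤ reTr τ y := by
  have := reTr_nonneg hτ (sub_nonneg.mpr hxy)
  rw [map_sub] at this
  linarith

lemma reTr_star {τ : A →L[ℂ] ℂ} (hτ : IsTracialState τ) (x : A) :
    reTr τ (star x) = reTr τ x := by
  let f : A →ₚ[ℂ] ℂ := PositiveLinearMap.mk₀ τ.toLinearMap
    fun x hx => nonneg_of_isTracialState hτ hx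
  have h : f (star x) = star (f x) := map_star f x
  have h' : τ (star x) = star (τ x) := h
  simp [reTr_apply, h']

lemma reTr_mul_nonneg {τ : A →L[ℂ] ℂ} (hτ : IsTracialState τ) {x y : A}
    (hx : 0 ≤ x) (hy : 0 ≤ y) : 0 ≤ reTr τ (x * y) := by
  obtain ⟨z, rfl⟩ := CStarAlgebra.nonneg_iff_eq_star_mul_self.mp hy
  rw [← mul_assoc, reTr_mul_comm hτ, ← mul_assoc]
  exact reTr_nonneg hτ (star_right_conjugate_nonneg hx z)

lemma reTr_mul_mono {τ : A →L[ℂ] ℂ} (hτ : IsTracialState τ) {x y z : A}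
    (hxy : x ≤ y) (hz : 0 ≤ z) : reTr τ (x * z) ≤ reTr τ (y * z) := by
  have := reTr_mul_nonneg hτ (sub_nonneg.mpr hxy) hz
  rw [sub_mul, map_sub] at this
  linarith

lemma reTr_mul_le {τ : A →L[ℂ] ℂ} (hτ : IsTracialState τ) (x : A) {y : A}
    (hy : 0 ≤ y) : reTr τ (x * y) ≤ ‖x‖ * reTr τ y := by
  have hsa : IsSelfAdjoint (x + star x) := IsSelfAdjoint.add_star_self x
  have h1 : x + star x ≤ algebraMap ℝ A (2 * ‖x‖) := by
    refine hsa.le_algebraMap_norm_self.trans ?_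
    refine algebraMap_mono A ?_
    calc ‖x + star x‖ ≤ ‖x‖ + ‖star x‖ := norm_add_le _ _
      _ = 2 * ‖x‖ := by rw [norm_star]; ring
  have h2 := reTr_mul_mono hτ h1 hy
  have h3 : reTr τ (star x * y) = reTr τ (x * y) := by
    rw [← reTr_star hτ (star x * y), star_mul, star_star, (IsSelfAdjoint.of_nonneg hy).star_eq,
      reTr_mul_comm hτ]
  rw [add_mul, map_add, h3, Algebra.algebraMap_eq_smul_one, smul_mul_assoc, one_mul,
    map_smul, smul_eq_mul] at h2
  linarith

lemma abs_reTr_mul_le {τ : A →L[ℂ] ℂ} (hτ : IsTracialState τ) (x : A) {y : A}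
    (hy : 0 ≤ y) : |reTr τ (x * y)| ≤ ‖x‖ * reTr τ y := by
  refine abs_le.mpr ⟨?_, reTr_mul_le hτ x hy⟩
  have := reTr_mul_le hτ (-x) hy
  rw [neg_mul, map_neg, norm_neg] at this
  linarith

lemma reTr_one [Nontrivial A] {τ : A →L[ℂ] ℂ} (hτ : IsTracialState τ) : reTr τ 1 = 1 := by
  apply le_antisymm
  · simpa using (abs_le.mp (abs_reTr_le hτ (1 : A))).2
  · rw [← hτ.2.1]
    have h1 : 0 ≤ reTr τ (1 : A) := reTr_nonneg hτ zero_le_one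
    refine τ.opNorm_le_bound h1 fun x => ?_
    obtain ⟨c, hc, hcx⟩ := RCLike.exists_norm_eq_mul_self (K := ℂ) (τ x)
    have h2 := reTr_mul_le hτ (c • x) (zero_le_one (α := A))
    rw [mul_one, norm_smul, hc, one_mul, reTr_apply, map_smul, smul_eq_mul, ← hcx] at h2
    simpa [mul_comm] using h2

lemma reTr_star_mul_self_add_le {τ : A →L[ℂ] ℂ} (hτ : IsTracialState τ) (x y : A) :
    reTr τ (star (x + y) * (x + y)) ≤
      2 * reTr τ (star x * x) + 2 * reTr τ (star y * y) := by
  have h := reTr_nonneg hτ (star_mul_self_nonneg (x - y))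
  simp only [star_sub, star_add, sub_mul, mul_sub, add_mul, mul_add, map_sub, map_add] at h ⊢
  linarith

/-- On a simple unital C*-algebra, tracial states are faithful. -/
lemma reTr_pos [IsSimpleRing A] {τ : A →L[ℂ] ℂ} (hτ : IsTracialState τ) {x : A}
    (hx : 0 ≤ x) (hx0 : x ≠ 0) : 0 < reTr τ x := by
  let I : TwoSidedIdeal A := TwoSidedIdeal.mk' {y | reTr τ (star y * y) = 0}
    (by simp)
    (by
      intro y z hy hz
      simp only [Set.mem_ofPred_eq] at hy hz ⊢
      refine le_antisymm ?_ (reTr_nonneg hτ (star_mul_self_nonneg _))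
      simpa [hy, hz] using reTr_star_mul_self_add_le hτ y z)
    (by intro y hy; simpa using hy)
    (by
      intro y z hz
      simp only [Set.mem_ofPred_eq] at hz ⊢
      refine le_antisymm ?_ (reTr_nonneg hτ (star_mul_self_nonneg _))
      have h1 := reTr_mul_le hτ (star y * y) (star_mul_self_nonneg (star z))
      have h2 : reTr τ (star y * y * (star (star z) * star z)) =
          reTr τ (star (y * z) * (y * z)) := by
        rw [star_star, ← mul_assoc, reTr_mul_comm hτ, star_mul]
        simp only [mul_assoc]
      rwa [h2, star_star, reTr_mul_comm hτ z, hz, mul_zero] at h1)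
    (by
      intro y z hy
      simp only [Set.mem_ofPred_eq] at hy ⊢
      refine le_antisymm ?_ (reTr_nonneg hτ (star_mul_self_nonneg _))
      have h1 := reTr_mul_le hτ (z * star z) (star_mul_self_nonneg y)
      have h2 : reTr τ (z * star z * (star y * y)) =
          reTr τ (star (y * z) * (y * z)) := by
        rw [mul_assoc, reTr_mul_comm hτ, star_mul]
        simp only [mul_assoc]
      rwa [h2, hy, mul_zero] at h1)
  have hI : ∀ y, y ∈ I ↔ reTr τ (star y * y) = 0 := fun y => by
    simp [I, TwoSidedIdeal.mem_mk']
  refine lt_of_le_of_ne (reTr_nonneg hτ hx) fun h0 => ?_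
  obtain ⟨y, rfl⟩ := CStarAlgebra.nonneg_iff_eq_star_mul_self.mp hx
  have hy : y ∈ I := (hI y).mpr h0.symm
  rcases eq_bot_or_eq_top I with h | h
  · rw [h, TwoSidedIdeal.mem_bot] at hy
    exact hx0 (by simp [hy])
  · have h1 : (1 : A) ∈ I := by rw [h]; trivial
    have := (hI 1).mp h1
    rw [star_one, one_mul, reTr_one hτ] at this
    exact one_ne_zero this

end TracialStates

section Cutoff

lemma continuous_fE (ε : ℝ) : Continuous (fE ε) := by
  unfold fE
  fun_prop

lemma fE_nonneg (ε t : ℝ) : 0 ≤ fE ε t := le_min zero_le_one (le_max_left _ _)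

lemma fE_le_one (ε t : ℝ) : fE ε t ≤ 1 := min_le_left _ _

lemma fE_eq_zero {ε t : ℝ} (hε : 0 < ε) (ht : t ≤ ε) : fE ε t = 0 := by
  have : (t - ε) / ε ≤ 0 := div_nonpos_of_nonpos_of_nonneg (by linarith) hε.le
  simp [fE, this]

lemma fE_eq_one {ε t : ℝ} (hε : 0 < ε) (ht : 2 * ε ≤ t) : fE ε t = 1 := by
  have : 1 ≤ (t - ε) / ε := by rw [le_div_iff₀ hε]; linarith
  simp [fE, this]

lemma fE_anti {ε δ : ℝ} (hδ : 0 < δ) (h : δ ≤ ε) (t : ℝ) : fE ε t ≤ fE δ t := by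
  rcases le_or_gt t δ with ht | ht
  · rw [fE_eq_zero (hδ.trans_le h) (ht.trans h)]
    exact fE_nonneg _ _
  · unfold fE
    have hε : 0 < ε := hδ.trans_le h
    gcongr min 1 (max 0 ?_)
    rw [div_le_div_iff₀ hε hδ]
    nlinarith

lemma fE_mul_fE {ε δ : ℝ} (hδ : 0 < δ) (h : 2 * δ ≤ ε) (t : ℝ) :
    fE δ t * fE ε t = fE ε t := by
  rcases le_or_gt t ε with ht | ht
  · rw [fE_eq_zero (by linarith) ht, mul_zero]
  · rw [fE_eq_one hδ (by linarith), one_mul]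

/-- The continuous function `t ↦ fE ε t / t`. -/
noncomputable def fEDiv (ε t : ℝ) : ℝ := fE ε t / max t ε

lemma continuous_fEDiv {ε : ℝ} (hε : 0 < ε) : Continuous (fEDiv ε) :=
  (continuous_fE ε).div (by fun_prop) fun t => (hε.trans_le (le_max_right t ε)).ne'

lemma mul_fEDiv {ε : ℝ} (hε : 0 < ε) (t : ℝ) : t * fEDiv ε t = fE ε t := by
  unfold fEDiv
  rcases le_or_gt t ε with ht | ht
  · simp [fE_eq_zero hε ht]
  · rw [max_eq_left ht.le]
    field_simp [(hε.trans ht).ne']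

lemma cfc_fE_eq_mul_left {ε : ℝ} (hε : 0 < ε) (a : A) (ha : IsSelfAdjoint a) :
    cfc (fE ε) a = a * cfc (fEDiv ε) a := by
  conv_rhs => enter [1]; rw [← cfc_id' ℝ a]
  rw [← cfc_mul _ _ a (by fun_prop) (continuous_fEDiv hε).continuousOn]
  simp only [mul_fEDiv hε]

lemma cfc_fE_eq_mul_right {ε : ℝ} (hε : 0 < ε) (a : A) (ha : IsSelfAdjoint a) :
    cfc (fE ε) a = cfc (fEDiv ε) a * a := by
  conv_rhs => enter [2]; rw [← cfc_id' ℝ a]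
  rw [← cfc_mul _ _ a (continuous_fEDiv hε).continuousOn (by fun_prop)]
  simp only [mul_comm _ (_ : ℝ), mul_fEDiv hε]

/-- `fE ε (b)` factors as `b m b` with `m` positive. -/
lemma exists_cfc_fE_eq_conj [PartialOrder A] [StarOrderedRing A] {ε : ℝ} (hε : 0 < ε) (b : A)
    (hb : IsSelfAdjoint b) : ∃ m : A, 0 ≤ m ∧ cfc (fE ε) b = b * m * b := by
  have hc : Continuous fun t => fE ε t / (max t ε) ^ 2 :=
    (continuous_fE ε).div (by fun_prop) fun t => by
      have := hε.trans_le (le_max_right t ε)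
      positivity
  refine ⟨cfc (fun t => fE ε t / (max t ε) ^ 2) b, ?_, ?_⟩
  · exact cfc_nonneg fun t _ => div_nonneg (fE_nonneg _ _) (sq_nonneg _)
  · nth_rewrite 2 [← cfc_id' ℝ b]
    nth_rewrite 4 [← cfc_id' ℝ b]
    rw [← cfc_mul _ _ b (by fun_prop) hc.continuousOn,
      ← cfc_mul (fun t => t * (fE ε t / (max t ε) ^ 2)) (fun t => t) b
        (continuous_id.mul hc).continuousOn (by fun_prop)]
    congr 1
    ext t
    rcases le_or_gt t ε with ht | ht
    · simp [fE_eq_zero hε ht]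
    · rw [max_eq_left ht.le]
      have := (hε.trans ht).ne'
      field_simp

lemma cfc_fE_nonneg [PartialOrder A] [StarOrderedRing A] (ε : ℝ) (a : A) :
    0 ≤ cfc (fE ε) a := cfc_nonneg fun t _ => fE_nonneg ε t

lemma norm_cfc_fE_le_one (ε : ℝ) (a : A) : ‖cfc (fE ε) a‖ ≤ 1 :=
  norm_cfc_le zero_le_one fun t _ => by
    rw [Real.norm_of_nonneg (fE_nonneg ε t)]
    exact fE_le_one ε t

lemma cfc_fE_anti [PartialOrder A] [StarOrderedRing A] {ε δ : ℝ} (hδ : 0 < δ) (h : δ ≤ ε) (a : A) :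
    cfc (fE ε) a ≤ cfc (fE δ) a :=
  cfc_mono (fun t _ => fE_anti hδ h t) (continuous_fE ε).continuousOn (continuous_fE δ).continuousOn

lemma cfc_fE_mul_cfc_fE {ε δ : ℝ} (hδ : 0 < δ) (h : 2 * δ ≤ ε) (a : A) :
    cfc (fE δ) a * cfc (fE ε) a = cfc (fE ε) a := by
  rw [← cfc_mul _ _ a (continuous_fE δ).continuousOn (continuous_fE ε).continuousOn]
  simp only [fE_mul_fE hδ h]

end Cutoff

section DTau

lemma bddAbove_range_reTr_cfc_fE {τ : A →L[ℂ] ℂ} (hτ : IsTracialState τ) (a : A) :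
    BddAbove (Set.range fun n : ℕ => (τ (cfc (fE (1 / (n + 1 : ℝ))) a)).re) := by
  refine ⟨1, ?_⟩
  rintro _ ⟨n, rfl⟩
  exact (abs_le.mp ((abs_reTr_le hτ _).trans (norm_cfc_fE_le_one _ _))).2

lemma reTr_cfc_fE_le_dTau {τ : A →L[ℂ] ℂ} (hτ : IsTracialState τ) (a : A) (n : ℕ) :
    reTr τ (cfc (fE (1 / (n + 1 : ℝ))) a) ≤ dTau τ a :=
  le_ciSup (bddAbove_range_reTr_cfc_fE hτ a) n

variable [PartialOrder A] [StarOrderedRing A]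

/-- If a continuous affine function lies below `d_τ(b)` on the (compact) trace space, then it lies
below `τ(f_{1/n}(b))` for some `n`. -/
lemma exists_forall_reTr_lt_reTr_cfc_fE [Nontrivial A] (b g : A)
    (h : ∀ τ ∈ traceSet A, reTr τ g < dTau τ b) :
    ∃ n : ℕ, ∀ τ ∈ traceSet A, reTr τ g < reTr τ (cfc (fE (1 / (n + 1 : ℝ))) b) := by
  let K : Set (WeakDual ℂ A) := WeakDual.toStrongDual ⁻¹' traceSet A
  have hev : ∀ x : A, Continuous fun τ : WeakDual ℂ A => τ x := WeakDual.eval_continuous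
  have hre : ∀ x : A, Continuous fun τ : WeakDual ℂ A => (τ x).re :=
    fun x => Complex.continuous_re.comp (hev x)
  have hK : K = WeakDual.toStrongDual ⁻¹' Metric.closedBall 0 1 ∩
      ({τ : WeakDual ℂ A | τ 1 = 1} ∩
      ((⋂ x : A, {τ : WeakDual ℂ A | 0 ≤ τ (star x * x)}) ∩
        ⋂ x : A, ⋂ y : A, {τ : WeakDual ℂ A | τ (x * y) = τ (y * x)})) := by
    ext τ
    simp only [Set.mem_inter_iff, Set.mem_iInter]
    constructor
    · intro (hτ : IsTracialState (WeakDual.toStrongDual τ))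
      refine ⟨by simpa using hτ.2.1.le, ?_, hτ.1, hτ.2.2⟩
      have h1 := reTr_one hτ
      have h2 := nonneg_of_isTracialState hτ (zero_le_one (α := A))
      exact Complex.ext h1 (Complex.le_def.mp h2).2.symm
    · rintro ⟨h1, h2, h3, h4⟩
      refine ⟨h3, le_antisymm (by simpa using h1) ?_, h4⟩
      have h5 := (WeakDual.toStrongDual τ).le_opNorm (1 : A)
      have h6 : (WeakDual.toStrongDual τ) (1 : A) = 1 := h2
      simpa [h6] using h5
  have hKc : IsCompact K := by
    rw [hK]
    refine (WeakDual.isCompact_closedBall 0 1).inter_right ?_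
    refine (isClosed_eq (hev 1) continuous_const).inter (IsClosed.inter ?_ ?_)
    · exact isClosed_iInter fun x => isClosed_le continuous_const (hev _)
    · exact isClosed_iInter fun x => isClosed_iInter fun y => isClosed_eq (hev _) (hev _)
  obtain ⟨s, hs⟩ := hKc.elim_finite_subcover
    (fun n : ℕ => {τ : WeakDual ℂ A | (τ g).re < (τ (cfc (fE (1 / (n + 1 : ℝ))) b)).re})
    (fun n => isOpen_lt (hre _) (hre _))
    (by
      intro τ hτ
      obtain ⟨n, hn⟩ := exists_lt_of_lt_ciSup (h (WeakDual.toStrongDual τ) hτ)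
      exact Set.mem_iUnion.mpr ⟨n, hn⟩)
  refine ⟨s.sup id, fun τ hτ => ?_⟩
  obtain ⟨n, hns, hn⟩ := Set.mem_iUnion₂.mp (hs (show StrongDual.toWeakDual τ ∈ K from hτ))
  have hle : n ≤ s.sup id := Finset.le_sup (f := id) hns
  refine lt_of_lt_of_le hn (reTr_mono hτ (cfc_fE_anti (by positivity) ?_ b))
  gcongr

end DTau

section Cutting

lemma reTr_cfc_fE_star_mul_self [Nontrivial A] {τ : A →L[ℂ] ℂ} (hτ : IsTracialState τ) (x : A)
    {ε : ℝ} (hε : 0 < ε) :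
    reTr τ (cfc (fE ε) (star x * x)) = reTr τ (cfc (fE ε) (x * star x)) := by
  rw [cfc_fE_eq_mul_left hε _ (IsSelfAdjoint.star_mul_self x),
    cfc_fE_eq_mul_left hε _ (IsSelfAdjoint.mul_star_self x),
    reTr_mul_cfc_star_mul_self hτ x (continuous_fEDiv hε)]

lemma tendsto_cfc_of_tendsto [Nontrivial A] {y : ℕ → A} {b : A} (hy : ∀ k, IsSelfAdjoint (y k))
    (hb : IsSelfAdjoint b) (h : Filter.Tendsto y Filter.atTop (nhds b)) {f : ℝ → ℝ}
    (hf : Continuous f) :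
    Filter.Tendsto (fun k => cfc f (y k)) Filter.atTop (nhds (cfc f b)) := by
  have hsub : ∀ z : A, ‖z‖ ≤ ‖b‖ + 1 → spectrum ℝ z ⊆ Set.Icc (-(‖b‖ + 1)) (‖b‖ + 1) :=
    fun z hz t ht => abs_le.mp ((spectrum.norm_le_norm_of_mem ht).trans hz)
  refine h.cfc isCompact_Icc f ?_ (Filter.Eventually.of_forall hy) (hsub b (by linarith)) hb
    hf.continuousOn
  filter_upwards [h.norm.eventually_lt_const (lt_add_one ‖b‖)] with k hk
  exact hsub _ hk.le

/-- A Cuntz subequivalence `b ≲ g²` can be replaced, as far as traces are concerned, by elements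
of the form `g m g`. -/
lemma eventually_abs_reTr_cfc_fE_sub_le [Nontrivial A] {b g : A} (hb : IsSelfAdjoint b)
    (hg : IsSelfAdjoint g) {x : ℕ → A}
    (hx : Filter.Tendsto (fun k => ‖b - star (x k) * (g * g) * x k‖) Filter.atTop (nhds 0))
    {ε η : ℝ} (hε : 0 < ε) (hη : 0 < η) :
    ∀ᶠ k in Filter.atTop, ∀ τ ∈ traceSet A,
      |reTr τ (cfc (fE ε) (g * (x k * star (x k)) * g)) - reTr τ (cfc (fE ε) b)| ≤ η := by
  have h1 : ∀ k, star (x k) * (g * g) * x k = star (g * x k) * (g * x k) := fun k => by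
    rw [star_mul, hg.star_eq]
    simp only [mul_assoc]
  have h2 : ∀ k, g * (x k * star (x k)) * g = g * x k * star (g * x k) := fun k => by
    rw [star_mul, hg.star_eq]
    simp only [mul_assoc]
  have hy : Filter.Tendsto (fun k => star (g * x k) * (g * x k)) Filter.atTop (nhds b) := by
    rw [tendsto_iff_norm_sub_tendsto_zero]
    simpa only [h1, norm_sub_rev] using hx
  have hc := tendsto_cfc_of_tendsto (fun k => IsSelfAdjoint.star_mul_self _) hb hy
    (continuous_fE ε)
  rw [tendsto_iff_norm_sub_tendsto_zero] at hc
  filter_upwards [hc.eventually_lt_const hη] with k hk τ hτ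
  rw [h2, ← reTr_cfc_fE_star_mul_self hτ _ hε, ← map_sub]
  exact (abs_reTr_le hτ _).trans hk.le

/-- The hypothesis of hereditary density, for functions of the form `τ ↦ τ(e)` with `e` positive. -/
def HereditaryDense (A : Type*) [CStarAlgebra A] [PartialOrder A] : Prop :=
  ∀ a : A, 0 ≤ a → ∀ ε : ℝ, 0 < ε → ∀ e : A, 0 ≤ e →
    (∀ τ ∈ traceSet A, reTr τ e < dTau τ a) →
    ∃ b : A, 0 ≤ b ∧ CuntzLe b a ∧ ∀ τ ∈ traceSet A, |reTr τ e - dTau τ b| < ε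

variable [PartialOrder A] [StarOrderedRing A]

lemma le_cfc_fE_add {a : A} (ha : 0 ≤ a) (ha1 : ‖a‖ ≤ 1) [Nontrivial A] {ε : ℝ} (hε : 0 < ε) :
    a ≤ cfc (fE (2 * ε)) a + algebraMap ℝ A (4 * ε) := by
  rw [← cfc_const (4 * ε) a, ← cfc_add a (fE (2 * ε)) (fun _ => 4 * ε)
    (continuous_fE _).continuousOn continuousOn_const]
  nth_rewrite 1 [← cfc_id' ℝ a]
  refine cfc_mono (fun t ht => ?_) (by fun_prop)
    ((continuous_fE _).add continuous_const).continuousOn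
  have h1 : t ≤ 1 := (le_abs_self t).trans ((spectrum.norm_le_norm_of_mem ht).trans ha1)
  rcases le_or_gt t (4 * ε) with h | h
  · linarith [fE_nonneg (2 * ε) t]
  · rw [fE_eq_one (by linarith) (by linarith)]
    linarith

lemma smul_le_mul_of_cfc_fE {τ : A →L[ℂ] ℂ} (hτ : IsTracialState τ) {a : A} (ha : 0 ≤ a)
    {ε : ℝ} (hε : 0 < ε) {m : A} (hm : 0 ≤ m) :
    ε * reTr τ (cfc (fE ε) a * m * cfc (fE ε) a) ≤
      reTr τ (a * (cfc (fE ε) a * m * cfc (fE ε) a)) := by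
  have hc := continuous_fE ε
  have h1 : 0 ≤ cfc (fE ε) a * (a - algebraMap ℝ A ε) * cfc (fE ε) a := by
    have h2 : cfc (fE ε) a * (a - algebraMap ℝ A ε) * cfc (fE ε) a =
        cfc (fun t => fE ε t * (t - ε) * fE ε t) a := by
      rw [cfc_mul (fun t => fE ε t * (t - ε)) (fE ε) a (by fun_prop) (by fun_prop),
        cfc_mul (fE ε) (fun t => t - ε) a (by fun_prop) (by fun_prop),
        cfc_sub (fun t => t) (fun _ => ε) a, cfc_const ε a, cfc_id' ℝ a]
    rw [h2]
    refine cfc_nonneg fun t _ => ?_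
    rcases le_or_gt t ε with h | h
    · simp [fE_eq_zero hε h]
    · have := fE_nonneg ε t
      have h3 : 0 ≤ t - ε := by linarith
      positivity
  have h4 := reTr_mul_nonneg hτ h1 hm
  have h5 : reTr τ (cfc (fE ε) a * (a - algebraMap ℝ A ε) * cfc (fE ε) a * m) =
      reTr τ (a * (cfc (fE ε) a * m * cfc (fE ε) a)) -
        ε * reTr τ (cfc (fE ε) a * m * cfc (fE ε) a) := by
    rw [mul_assoc, mul_assoc, reTr_mul_comm hτ, mul_assoc, mul_assoc, sub_mul, map_sub,
      Algebra.algebraMap_eq_smul_one, smul_mul_assoc, one_mul, map_smul, smul_eq_mul, ← mul_assoc]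
  linarith

/-- One step of the exhaustion: under hereditary density, one can cut from a positive contraction
`a` an approximate projection `p` (with approximate units `p'` and `p''`) which captures a fixed
proportion of the trace of `a`. -/
lemma exists_cut [IsSimpleRing A] (H : HereditaryDense A) {a : A} (ha : 0 ≤ a) (ha1 : ‖a‖ ≤ 1)
    {ε η : ℝ} (hε : 0 < ε) (hη : 0 < η) :
    ∃ p p' p'' : A, (∃ x, p = a * x * a) ∧ (∃ x, p' = a * x * a) ∧ (∃ x, p'' = a * x * a) ∧
      0 ≤ p ∧ 0 ≤ p' ∧ p ≤ p'' ∧ p' ≤ p'' ∧ ‖p'‖ ≤ 1 ∧ ‖p''‖ ≤ 1 ∧ p' * p = p ∧ p'' * p' = p' ∧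
      (∀ τ ∈ traceSet A, reTr τ p'' ≤ reTr τ p + η) ∧
      ∀ τ ∈ traceSet A, ε * (reTr τ a - 4 * ε - η) ≤ reTr τ (a * p) := by
  have hsa : IsSelfAdjoint a := .of_nonneg ha
  have htr : ∀ τ ∈ traceSet A, reTr τ a ≤ reTr τ (cfc (fE (2 * ε)) a) + 4 * ε := by
    intro τ hτ
    have h := reTr_mono hτ (le_cfc_fE_add ha ha1 hε)
    rwa [map_add, Algebra.algebraMap_eq_smul_one, map_smul, reTr_one hτ, smul_eq_mul, mul_one] at h
  by_cases hf0 : cfc (fE (2 * ε)) a = 0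
  · refine ⟨0, 0, 0, ⟨0, by simp⟩, ⟨0, by simp⟩, ⟨0, by simp⟩, le_rfl, le_rfl, le_rfl, le_rfl,
      by simp, by simp, by simp, by simp, fun τ _ => by simpa using hη.le, fun τ hτ => ?_⟩
    have h := htr τ hτ
    rw [hf0, map_zero, zero_add] at h
    rw [mul_zero, map_zero]
    exact mul_nonpos_of_nonneg_of_nonpos hε.le (by linarith)
  set f := cfc (fE (2 * ε)) a with hf
  set g := cfc (fE ε) a with hg
  have hfn : 0 ≤ f := cfc_fE_nonneg _ a
  have hgsa : IsSelfAdjoint g := .of_nonneg (cfc_fE_nonneg _ a)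
  have hf1 : ∀ τ ∈ traceSet A, reTr τ f ≤ 1 := fun τ hτ =>
    (le_abs_self _).trans ((abs_reTr_le hτ f).trans (norm_cfc_fE_le_one _ _))
  have hdom : ∀ τ ∈ traceSet A, reTr τ f ≤ dTau τ (g * g) := by
    intro τ hτ
    refine le_trans (reTr_mono hτ ?_) (reTr_cfc_fE_le_dTau hτ (g * g) 1)
    have hc := continuous_fE ε
    have hc2 := continuous_fE (1 / ((1 : ℕ) + 1 : ℝ))
    rw [hg, ← cfc_mul (fE ε) (fE ε) a (by fun_prop) (by fun_prop),
      ← cfc_comp' (fE (1 / ((1 : ℕ) + 1 : ℝ))) (fun t => fE ε t * fE ε t) a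
        (by fun_prop) (by fun_prop)]
    refine cfc_mono (fun t _ => ?_) (continuous_fE _).continuousOn (by fun_prop)
    rcases le_or_gt t (2 * ε) with h | h
    · rw [fE_eq_zero (by linarith) h]
      exact fE_nonneg _ _
    · rw [fE_eq_one hε h.le,
        fE_eq_one (ε := 1 / ((1 : ℕ) + 1 : ℝ)) (t := 1 * 1) (by positivity) (by norm_num)]
      exact fE_le_one _ _
  -- the constant `κ` makes the inequality `τ(f) < d_τ(g²)` strict
  obtain ⟨κ, hκ0, hκ1, hκη⟩ : ∃ κ : ℝ, 0 < κ ∧ κ ≤ 1 ∧ κ ≤ η / 8 :=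
    ⟨min 1 (η / 8), by positivity, min_le_left _ _, min_le_right _ _⟩
  obtain ⟨b, hb, ⟨x, hx⟩, hbτ⟩ := H (g * g) hgsa.mul_self_nonneg (η / 8) (by positivity)
    ((1 - κ) • f) (smul_nonneg (by linarith) hfn) (by
      intro τ hτ
      have h1 := reTr_pos hτ hfn hf0
      rw [map_smul, smul_eq_mul]
      have h2 := hdom τ hτ
      nlinarith)
  obtain ⟨n, hn⟩ := exists_forall_reTr_lt_reTr_cfc_fE b ((1 - κ) • f - (η / 8) • (1 : A)) (by
    intro τ hτ
    have := abs_lt.mp (hbτ τ hτ)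
    rw [map_sub, map_smul (reTr τ) (η / 8), reTr_one hτ, smul_eq_mul, mul_one]
    linarith [this.2])
  set δ : ℝ := 1 / (n + 1 : ℝ) with hδ
  have hδ0 : 0 < δ := by positivity
  have hδ4 : δ / 4 = 1 / (((4 * n + 3 : ℕ) : ℝ) + 1) := by
    rw [hδ]; push_cast; field_simp; ring
  obtain ⟨k, hk1, hk2⟩ := ((eventually_abs_reTr_cfc_fE_sub_le (.of_nonneg hb) hgsa hx hδ0
    (show 0 < η / 8 by positivity)).and (eventually_abs_reTr_cfc_fE_sub_le (.of_nonneg hb) hgsa hx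
    (show 0 < δ / 4 by positivity) (show 0 < η / 8 by positivity))).exists
  set b₁ := g * (x k * star (x k)) * g with hb₁
  have hb₁n : 0 ≤ b₁ := hgsa.conjugate_nonneg (mul_star_self_nonneg _)
  have hmem : ∀ ε' : ℝ, 0 < ε' → ∃ y, cfc (fE ε') b₁ = a * y * a := by
    intro ε' hε'
    obtain ⟨m, -, hm⟩ := exists_cfc_fE_eq_conj hε' b₁ (.of_nonneg hb₁n)
    have hgl : g = a * cfc (fEDiv ε) a := cfc_fE_eq_mul_left hε a hsa
    have hgr : g = cfc (fEDiv ε) a * a := cfc_fE_eq_mul_right hε a hsa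
    refine ⟨cfc (fEDiv ε) a * (x k * star (x k)) * g * m * g * (x k * star (x k)) *
      cfc (fEDiv ε) a, ?_⟩
    calc cfc (fE ε') b₁ = g * ((x k * star (x k)) * g * m * g * (x k * star (x k))) * g := by
          rw [hm, hb₁]; simp only [mul_assoc]
      _ = a * cfc (fEDiv ε) a * ((x k * star (x k)) * g * m * g * (x k * star (x k))) *
          (cfc (fEDiv ε) a * a) := by rw [← hgl, ← hgr]
      _ = _ := by simp only [mul_assoc]
  have hτp : ∀ τ ∈ traceSet A, reTr τ f - η ≤ reTr τ (cfc (fE δ) b₁) := by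
    intro τ hτ
    have h1 := hn τ hτ
    have h2 := abs_le.mp (hk1 τ hτ)
    have h3 := hf1 τ hτ
    have h4 := reTr_nonneg hτ hfn
    rw [map_sub, map_smul, map_smul (reTr τ) (η / 8), reTr_one hτ, smul_eq_mul, smul_eq_mul,
      mul_one] at h1
    nlinarith [h2.1]
  refine ⟨cfc (fE δ) b₁, cfc (fE (δ / 2)) b₁, cfc (fE (δ / 4)) b₁, hmem _ hδ0,
    hmem _ (by positivity), hmem _ (by positivity), cfc_fE_nonneg _ _, cfc_fE_nonneg _ _,
    cfc_fE_anti (by positivity) (by linarith) _, cfc_fE_anti (by positivity) (by linarith) _,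
    norm_cfc_fE_le_one _ _, norm_cfc_fE_le_one _ _,
    cfc_fE_mul_cfc_fE (by positivity) (by linarith) _,
    cfc_fE_mul_cfc_fE (by positivity) (by linarith) _, fun τ hτ => ?_, fun τ hτ => ?_⟩
  · have h1 := hn τ hτ
    have h2 := abs_le.mp (hk1 τ hτ)
    have h3 := abs_le.mp (hk2 τ hτ)
    have h4 := reTr_cfc_fE_le_dTau hτ b (4 * n + 3)
    have h5 := abs_lt.mp (hbτ τ hτ)
    rw [← hδ4] at h4
    rw [map_sub, map_smul (reTr τ) (η / 8), reTr_one hτ, smul_eq_mul, mul_one] at h1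
    linarith [h2.1, h3.2, h5.1]
  · obtain ⟨m, hm0, hm⟩ := exists_cfc_fE_eq_conj hδ0 b₁ (.of_nonneg hb₁n)
    have hp : cfc (fE δ) b₁ =
        g * ((x k * star (x k)) * (g * m * g) * (x k * star (x k))) * g := by
      rw [hm, hb₁]; simp only [mul_assoc]
    have hM : 0 ≤ (x k * star (x k)) * (g * m * g) * (x k * star (x k)) :=
      (IsSelfAdjoint.mul_star_self (x k)).conjugate_nonneg (hgsa.conjugate_nonneg hm0)
    have h1 := smul_le_mul_of_cfc_fE hτ ha hε hM
    rw [← hg, ← hp] at h1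
    refine le_trans ?_ h1
    gcongr
    linarith [htr τ hτ, hτp τ hτ]

end Cutting

section Exhaustion

variable [PartialOrder A] [StarOrderedRing A]

lemma add_le_one_of_mul_eq_zero {p p' e : A} (hp : 0 ≤ p) (hp1 : p ≤ 1) (hp' : 0 ≤ p')
    (hp'1 : p' ≤ 1) (h : p' * p = p) (he : 0 ≤ e) (he1 : e ≤ 1) (h0 : p' * e = 0) :
    p + e ≤ 1 := by
  have hp's : IsSelfAdjoint p' := .of_nonneg hp'
  have h' : p * p' = p := by
    have := congrArg star h
    rwa [star_mul, hp's.star_eq, (IsSelfAdjoint.of_nonneg hp).star_eq] at this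
  have h0' : e * p' = 0 := by
    have := congrArg star h0
    rwa [star_mul, hp's.star_eq, (IsSelfAdjoint.of_nonneg he).star_eq, star_zero] at this
  have h1 : p' * p * p' ≤ p' * 1 * p' := hp's.conjugate_le_conjugate hp1
  have hqs : IsSelfAdjoint (1 - p') := (IsSelfAdjoint.one A).sub hp's
  have h2 : (1 - p') * e * (1 - p') ≤ (1 - p') * 1 * (1 - p') := hqs.conjugate_le_conjugate he1
  have h3 : p' * p' ≤ p' := by
    simpa [sq] using CStarAlgebra.pow_antitone hp' hp'1 (show 1 ≤ 2 by norm_num)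
  have h4 : (1 - p') * e * (1 - p') = e := by
    rw [sub_mul, h0, one_mul, sub_zero, mul_sub, h0', mul_one, sub_zero]
  rw [h, h', mul_one] at h1
  rw [h4, mul_one] at h2
  calc p + e ≤ p' * p' + (1 - p') * (1 - p') := add_le_add h1 h2
    _ = 1 - 2 • (p' - p' * p') := by noncomm_ring
    _ ≤ 1 := by
      rw [sub_le_self_iff]
      exact nsmul_nonneg (sub_nonneg.mpr h3) 2

/-- Iterating `exists_cut`: after `N` steps the part of the trace of `a` exceeding `4ε` which is
not captured has decreased by the factor `(1 - ε) ^ N`. -/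
lemma exists_cut_iterate [IsSimpleRing A] (H : HereditaryDense A) {ε : ℝ} (hε : 0 < ε)
    (hε1 : ε ≤ 1) (N : ℕ) : ∀ η : ℝ, 0 < η → ∀ a : A, 0 ≤ a → ‖a‖ ≤ 1 →
    ∃ e e' : A, (∃ x, e = a * x * a) ∧ (∃ x, e' = a * x * a) ∧ 0 ≤ e ∧ e ≤ 1 ∧ 0 ≤ e' ∧
      e' * e = e ∧ (∀ τ ∈ traceSet A, reTr τ e' ≤ reTr τ e + η) ∧
      ∀ τ ∈ traceSet A,
        reTr τ (a * (1 - e)) ≤ 4 * ε + (1 - ε) ^ N * (reTr τ a - 4 * ε) + η := by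
  induction N with
  | zero =>
    intro η hη a ha ha1
    refine ⟨0, 0, ⟨0, by simp⟩, ⟨0, by simp⟩, le_rfl, zero_le_one, le_rfl, by simp,
      fun τ _ => by simpa using hη.le, fun τ _ => ?_⟩
    simp only [sub_zero, mul_one, pow_zero, one_mul]
    linarith
  | succ N ih =>
    intro η hη a ha ha1
    have has : IsSelfAdjoint a := .of_nonneg ha
    obtain ⟨p, p', p'', ⟨xp, hxp⟩, ⟨xp', hxp'⟩, ⟨m, hm⟩, hp, hp', hle₁, hle₂, hp'1, hp''1, hp'p,
      hmul₃, hτ1, hτ2⟩ := exists_cut H ha ha1 hε (show 0 < η / 8 by positivity)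
    have hp'' : 0 ≤ p'' := hp'.trans hle₂
    have hp''le : p'' ≤ 1 := (CStarAlgebra.norm_le_one_iff_of_nonneg p'' hp'').mp hp''1
    have hps : IsSelfAdjoint p := .of_nonneg hp
    have hp's : IsSelfAdjoint p' := .of_nonneg hp'
    have hp''s : IsSelfAdjoint p'' := .of_nonneg hp''
    set q := 1 - p'' with hq
    have hqs : IsSelfAdjoint q := (IsSelfAdjoint.one A).sub hp''s
    have hq0 : 0 ≤ q := sub_nonneg.mpr hp''le
    have hq1 : q ≤ 1 := sub_le_self _ hp''
    have hqn : ‖q‖ ≤ 1 := (CStarAlgebra.norm_le_one_iff_of_nonneg q hq0).mpr hq1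
    have ha₁ : 0 ≤ q * a * q := hqs.conjugate_nonneg ha
    have ha₁1 : ‖q * a * q‖ ≤ 1 := by
      calc ‖q * a * q‖ ≤ ‖q‖ * ‖a‖ * ‖q‖ := norm_mul₃_le
        _ ≤ 1 * 1 * 1 := by gcongr
        _ = 1 := by norm_num
    obtain ⟨e₁, e₁', ⟨x, hx⟩, ⟨x', hx'⟩, he₁, he₁1, he₁', he₁e, hτ3, hτ4⟩ :=
      ih (η / 8) (by positivity) _ ha₁ ha₁1
    have he₁n : ‖e₁‖ ≤ 1 := (CStarAlgebra.norm_le_one_iff_of_nonneg e₁ he₁).mpr he₁1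
    have hmul₁ : p' * p'' = p' := by
      have := congrArg star hmul₃
      rwa [star_mul, hp's.star_eq, hp''s.star_eq] at this
    have hpp' : p * p' = p := by
      have := congrArg star hp'p
      rwa [star_mul, hps.star_eq, hp's.star_eq] at this
    have hp'q : p' * q = 0 := by rw [hq, mul_sub, mul_one, hmul₁, sub_self]
    have hqp' : q * p' = 0 := by rw [hq, sub_mul, one_mul, hmul₃, sub_self]
    have hp'e : p' * e₁ = 0 := by rw [hx]; simp only [← mul_assoc, hp'q, zero_mul]
    have hep' : e₁ * p' = 0 := by rw [hx]; simp only [mul_assoc, hqp', mul_zero]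
    have hep : e₁ * p = 0 := by rw [← hp'p, ← mul_assoc, hep', zero_mul]
    have hpe : p * e₁ = 0 := by rw [← hpp', mul_assoc, hp'e, mul_zero]
    have he'p : e₁' * p = 0 := by
      rw [← hp'p, hx']
      simp only [← mul_assoc]
      simp only [mul_assoc _ q p', hqp', mul_zero, zero_mul]
    have hp''p : p'' * p = p := by rw [← hp'p, ← mul_assoc, hmul₃]
    have hmem : ∀ y : A, ∃ z, q * a * q * y * (q * a * q) = a * z * a := by
      intro y
      have h1 : q * a = a * (1 - m * a * a) := by rw [hq, hm]; noncomm_ring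
      have h2 : a * q = (1 - a * a * m) * a := by rw [hq, hm]; noncomm_ring
      refine ⟨(1 - m * a * a) * q * y * q * (1 - a * a * m), ?_⟩
      calc q * a * q * y * (q * a * q) = (q * a) * (q * y * q) * (a * q) := by
            simp only [mul_assoc]
        _ = _ := by rw [h1, h2]; simp only [mul_assoc]
    obtain ⟨z, hz⟩ := hmem x
    obtain ⟨z', hz'⟩ := hmem x'
    refine ⟨p + e₁, p' + e₁', ⟨xp + z, ?_⟩, ⟨xp' + z', ?_⟩, add_nonneg hp he₁, ?_,
      add_nonneg hp' he₁', ?_, fun τ hτ => ?_, fun τ hτ => ?_⟩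
    · rw [hx, hz, mul_add, add_mul, ← hxp]
    · rw [hx', hz', mul_add, add_mul, ← hxp']
    · exact add_le_one_of_mul_eq_zero hp (hle₁.trans hp''le) hp' (hle₂.trans hp''le) hp'p
        he₁ he₁1 hp'e
    · rw [add_mul, mul_add, mul_add, hp'p, hp'e, he'p, he₁e, add_zero, zero_add]
    · have h1 := hτ1 τ hτ
      have h2 := hτ3 τ hτ
      have h3 := reTr_mono hτ hle₂
      rw [map_add, map_add]
      linarith
    · set r := p'' - p with hr
      have hr0 : 0 ≤ r := sub_nonneg.mpr hle₁
      have hrn : ‖r‖ ≤ 1 := (CStarAlgebra.norm_le_one_iff_of_nonneg r hr0).mpr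
        ((sub_le_self _ hp).trans hp''le)
      have hτr : reTr τ r ≤ η / 8 := by
        have := hτ1 τ hτ
        rw [hr, map_sub]
        linarith
      have hτr0 := reTr_nonneg hτ hr0
      have key : ∀ y : A, ‖y‖ ≤ 1 → |reTr τ (y * r)| ≤ η / 8 := fun y hy =>
        (abs_reTr_mul_le hτ y hr0).trans ((mul_le_of_le_one_left hτr0 hy).trans hτr)
      have hid : 1 - (p + e₁) = q * (1 - e₁) * q + (r + r - p'' * r - r * e₁ - e₁ * r +
          r * e₁ * r) := by
        have h1 : q * (1 - e₁) * q = 1 - p'' - p'' + p'' * p'' - e₁ + p'' * e₁ + e₁ * p'' -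
            p'' * e₁ * p'' := by rw [hq]; noncomm_ring
        have h2 : r * e₁ = p'' * e₁ := by rw [hr, sub_mul, hpe, sub_zero]
        have h3 : e₁ * r = e₁ * p'' := by rw [hr, mul_sub, hep, sub_zero]
        have h4 : p'' * r = p'' * p'' - p := by rw [hr, mul_sub, hp''p]
        rw [h1, h4, h2, mul_assoc p'' e₁ r, h3, mul_assoc p'' e₁ p'', hr]
        abel
      have hle1 : ∀ y z : A, ‖y‖ ≤ 1 → ‖z‖ ≤ 1 → ‖y * z‖ ≤ 1 := fun y z hy hz =>
        (norm_mul_le _ _).trans (mul_le_one₀ hy (norm_nonneg _) hz)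
      have k1 := abs_le.mp (key a ha1)
      have k2 := abs_le.mp (key (a * p'') (hle1 _ _ ha1 hp''1))
      have k3 := abs_le.mp (key (e₁ * a) (hle1 _ _ he₁n ha1))
      have k4 := abs_le.mp (key (a * e₁) (hle1 _ _ ha1 he₁n))
      have k5 := abs_le.mp (key (a * r * e₁) (hle1 _ _ (hle1 _ _ ha1 hrn) he₁n))
      have k3' : reTr τ (a * (r * e₁)) = reTr τ (e₁ * a * r) := by
        rw [← mul_assoc, reTr_mul_comm hτ, mul_assoc]
      have hmain : reTr τ (a * (1 - (p + e₁))) ≤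
          reTr τ (q * a * q * (1 - e₁)) + 6 * (η / 8) := by
        have h5 : reTr τ (a * (q * (1 - e₁) * q)) = reTr τ (q * a * q * (1 - e₁)) := by
          rw [← mul_assoc, reTr_mul_comm hτ]; simp only [mul_assoc]
        rw [hid]
        simp only [mul_add, mul_sub, map_add, map_sub, k3'] at h5 ⊢
        simp only [← mul_assoc] at h5 k1 k2 k3 k4 k5 ⊢
        linarith [k1.2, k2.1, k3.1, k4.1, k5.2]
      have hq2 : q * q ≤ q := by
        simpa [sq] using CStarAlgebra.pow_antitone hq0 hq1 (show 1 ≤ 2 by norm_num)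
      have ha₁τ : reTr τ (q * a * q) ≤ reTr τ a - reTr τ (a * p) := by
        calc reTr τ (q * a * q) = reTr τ (q * q * a) := by
              rw [reTr_mul_comm hτ, mul_assoc]
          _ ≤ reTr τ (q * a) := reTr_mul_mono hτ hq2 ha
          _ ≤ reTr τ ((1 - p) * a) := reTr_mul_mono hτ (sub_le_sub_left hle₁ 1) ha
          _ = reTr τ a - reTr τ (a * p) := by
            rw [sub_mul, one_mul, map_sub, reTr_mul_comm hτ p a]
      have h6 := hτ2 τ hτ
      have h7 := hτ4 τ hτ
      have h8 : 0 ≤ (1 - ε) ^ N := pow_nonneg (by linarith) _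
      have h9 : (1 - ε) ^ N ≤ 1 := pow_le_one₀ (by linarith) (by linarith)
      have h10 : (1 - ε) ^ N * (reTr τ (q * a * q) - 4 * ε) ≤
          (1 - ε) ^ (N + 1) * (reTr τ a - 4 * ε) + η / 8 := by
        calc (1 - ε) ^ N * (reTr τ (q * a * q) - 4 * ε)
            ≤ (1 - ε) ^ N * ((1 - ε) * (reTr τ a - 4 * ε) + ε * (η / 8)) := by
              gcongr
              linarith
          _ = (1 - ε) ^ (N + 1) * (reTr τ a - 4 * ε) + (1 - ε) ^ N * (ε * (η / 8)) := by ring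
          _ ≤ (1 - ε) ^ (N + 1) * (reTr τ a - 4 * ε) + 1 * (1 * (η / 8)) := by gcongr
          _ = _ := by ring
      linarith

lemma exists_almost_unit [IsSimpleRing A] (H : HereditaryDense A) {a : A} (ha : 0 ≤ a) {θ : ℝ}
    (hθ : 0 < θ) :
    ∃ e e' : A, (∃ x, e = a * x * a) ∧ 0 ≤ e ∧ e ≤ 1 ∧ 0 ≤ e' ∧ e' * e = e ∧
      (∀ τ ∈ traceSet A, reTr τ e' ≤ reTr τ e + θ) ∧
      ∀ τ ∈ traceSet A, reTr τ (a * (1 - e)) ≤ θ := by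
  set s : ℝ := ‖a‖ + 1 with hs
  have hs1 : 1 ≤ s := by linarith [norm_nonneg a]
  have hs0 : 0 < s := by linarith
  have ha₀ : 0 ≤ s⁻¹ • a := smul_nonneg (by positivity) ha
  have ha₀1 : ‖s⁻¹ • a‖ ≤ 1 := by
    rw [norm_smul, norm_inv, Real.norm_of_nonneg hs0.le, inv_mul_le_iff₀ hs0]
    linarith
  set θ' : ℝ := θ / s with hθ'
  have hθ'0 : 0 < θ' := by positivity
  have hθ'1 : θ' ≤ θ := div_le_self hθ.le hs1
  obtain ⟨ε, hε0, hε1, hεθ⟩ : ∃ ε : ℝ, 0 < ε ∧ ε ≤ 1 ∧ ε ≤ θ' / 12 :=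
    ⟨min 1 (θ' / 12), by positivity, min_le_left _ _, min_le_right _ _⟩
  obtain ⟨N, hN⟩ := exists_pow_lt_of_lt_one (show 0 < θ' / 3 by positivity)
    (show 1 - ε < 1 by linarith)
  obtain ⟨e, e', ⟨x, hx⟩, -, he, he1, he', he'e, h1, h2⟩ :=
    exists_cut_iterate H hε0 hε1 N (θ' / 3) (by positivity) _ ha₀ ha₀1
  refine ⟨e, e', ⟨(s⁻¹ * s⁻¹) • x, ?_⟩, he, he1, he', he'e, fun τ hτ => ?_, fun τ hτ => ?_⟩
  · rw [hx]
    simp only [smul_mul_assoc, mul_smul_comm, smul_smul]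
  · linarith [h1 τ hτ]
  · have h3 := h2 τ hτ
    have h4 : reTr τ (s⁻¹ • a) ≤ 1 := (le_abs_self _).trans ((abs_reTr_le hτ _).trans ha₀1)
    have h5 : (1 - ε) ^ N * (reTr τ (s⁻¹ • a) - 4 * ε) ≤ θ' / 3 := by
      calc (1 - ε) ^ N * (reTr τ (s⁻¹ • a) - 4 * ε) ≤ (1 - ε) ^ N * 1 := by
            have : 0 ≤ (1 - ε) ^ N := pow_nonneg (by linarith) _
            gcongr
            linarith
        _ ≤ θ' / 3 := by linarith
    have h6 : s⁻¹ * reTr τ (a * (1 - e)) ≤ θ' := by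
      rw [smul_mul_assoc, map_smul, smul_eq_mul] at h3
      linarith
    rwa [hθ', inv_mul_le_iff₀ hs0, mul_div_cancel₀ _ hs0.ne'] at h6

end Exhaustion

section Oscillation

variable [PartialOrder A] [StarOrderedRing A]

lemma norm_one_sub_cfc_fE_conj_le [Nontrivial A] {c : A} (hc : 0 ≤ c) {ε : ℝ} (hε : 0 < ε) :
    ‖(1 - cfc (fE ε) c) * c * (1 - cfc (fE ε) c)‖ ≤ 2 * ε := by
  have hf := continuous_fE ε
  have h : (1 - cfc (fE ε) c) * c * (1 - cfc (fE ε) c) =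
      cfc (fun t => (1 - fE ε t) * t * (1 - fE ε t)) c := by
    rw [cfc_mul (fun t => (1 - fE ε t) * t) (fun t => 1 - fE ε t) c (by fun_prop) (by fun_prop),
      cfc_mul (fun t => 1 - fE ε t) (fun t => t) c (by fun_prop) (by fun_prop),
      cfc_sub (fun _ => 1) (fE ε) c, cfc_const_one ℝ c, cfc_id' ℝ c]
  rw [h]
  refine norm_cfc_le (by positivity) fun t ht => ?_
  have ht0 : 0 ≤ t := spectrum_nonneg_of_nonneg hc ht
  rcases le_or_gt t (2 * ε) with h2 | h2
  · have h0 : 0 ≤ 1 - fE ε t := sub_nonneg.mpr (fE_le_one ε t)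
    have h1 : 1 - fE ε t ≤ 1 := sub_le_self _ (fE_nonneg ε t)
    rw [Real.norm_of_nonneg (by positivity)]
    calc (1 - fE ε t) * t * (1 - fE ε t) ≤ 1 * (2 * ε) * 1 := by gcongr
      _ = 2 * ε := by ring
  · rw [fE_eq_one hε h2.le]
    simpa using hε.le

/-- If `c` has a local unit `e'` whose trace is uniformly almost that of some contraction `e` with
`e² ≲ c`, then the oscillation of `c` is small. -/
lemma osc_le [Nontrivial A] (hT : (traceSet A).Nonempty) {c e e' : A} (hc : 0 ≤ c) (he : 0 ≤ e)
    (he1 : e ≤ 1) (he' : 0 ≤ e') (hec : e' * c = c) {κ η : ℝ} (hκ : 0 < κ)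
    (hle : κ • (e * e) ≤ c) (hτ : ∀ τ ∈ traceSet A, reTr τ e' ≤ reTr τ e + η) : osc c ≤ η := by
  have : Nonempty ↥(traceSet A) := hT.to_subtype
  refine le_of_forall_pos_le_add fun δ hδ => ?_
  obtain ⟨n, hn⟩ := exists_nat_one_div_lt (show 0 < κ * δ ^ 2 / 2 by positivity)
  have hbdd : BddBelow (Set.range fun n : ℕ => ⨆ τ : ↥(traceSet A),
      (dTau (τ : A →L[ℂ] ℂ) c - ((τ : A →L[ℂ] ℂ) (cfc (fE (1 / (n + 1 : ℝ))) c)).re)) := by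
    refine ⟨0, ?_⟩
    rintro _ ⟨k, rfl⟩
    exact Real.iSup_nonneg fun τ => sub_nonneg.mpr (reTr_cfc_fE_le_dTau τ.2 c k)
  refine (ciInf_le hbdd n).trans (ciSup_le fun τ => ?_)
  have hes : IsSelfAdjoint e := .of_nonneg he
  have hd : dTau (τ : A →L[ℂ] ℂ) c ≤ reTr τ e' := by
    refine ciSup_le fun k => ?_
    have hk : (0 : ℝ) < 1 / (k + 1 : ℝ) := by positivity
    have h1 : e' * cfc (fE (1 / (k + 1 : ℝ))) c = cfc (fE (1 / (k + 1 : ℝ))) c := by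
      rw [cfc_fE_eq_mul_left hk c (.of_nonneg hc), ← mul_assoc, hec]
    rw [← reTr_apply, ← h1, reTr_mul_comm τ.2]
    refine (reTr_mul_le τ.2 _ he').trans (mul_le_of_le_one_left (reTr_nonneg τ.2 he') ?_)
    exact norm_cfc_fE_le_one _ c
  have hε : (0 : ℝ) < 1 / (n + 1 : ℝ) := by positivity
  set f := cfc (fE (1 / (n + 1 : ℝ))) c with hf
  have hf0 : 0 ≤ f := cfc_fE_nonneg _ c
  have hfs : IsSelfAdjoint (1 - f) := (IsSelfAdjoint.one A).sub (.of_nonneg hf0)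
  have h1 : ‖e * (1 - f)‖ ≤ δ := by
    have h2 : e * e ≤ κ⁻¹ • c := by
      have := smul_le_smul_of_nonneg_left hle (inv_nonneg.mpr hκ.le)
      rwa [smul_smul, inv_mul_cancel₀ hκ.ne', one_smul] at this
    have h3 := CStarAlgebra.norm_le_norm_of_nonneg_of_le
      (hfs.conjugate_nonneg hes.mul_self_nonneg) (hfs.conjugate_le_conjugate h2)
    have h4 : star (e * (1 - f)) * (e * (1 - f)) = (1 - f) * (e * e) * (1 - f) := by
      rw [star_mul, hes.star_eq, hfs.star_eq]; simp only [mul_assoc]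
    rw [← h4, CStarRing.norm_star_mul_self, mul_smul_comm, smul_mul_assoc, norm_smul,
      Real.norm_of_nonneg (inv_nonneg.mpr hκ.le)] at h3
    have h5 : κ⁻¹ * ‖(1 - f) * c * (1 - f)‖ ≤ δ ^ 2 := by
      rw [inv_mul_le_iff₀ hκ]
      linarith [norm_one_sub_cfc_fE_conj_le hc hε]
    exact le_of_sq_le_sq (by rw [sq]; exact h3.trans h5) hδ.le
  have h2 : 0 ≤ reTr (τ : A →L[ℂ] ℂ) ((1 - e) * f) :=
    reTr_mul_nonneg τ.2 (sub_nonneg.mpr he1) hf0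
  have h3 := (abs_le.mp ((abs_reTr_le τ.2 _).trans h1)).2
  rw [sub_mul, one_mul, map_sub] at h2
  rw [mul_sub, mul_one, map_sub] at h3
  rw [← reTr_apply]
  linarith [hτ τ τ.2]

lemma reTr_star_mul_self_compress_le {τ : A →L[ℂ] ℂ} (hτ : IsTracialState τ) {a e : A}
    (ha : 0 ≤ a) (he : 0 ≤ e) (he1 : e ≤ 1) {θ : ℝ} (h : reTr τ (a * (1 - e)) ≤ θ) :
    reTr τ (star (a - e * a * e) * (a - e * a * e)) ≤ 4 * (‖a‖ * θ) := by
  have has : IsSelfAdjoint a := .of_nonneg ha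
  have hes : IsSelfAdjoint e := .of_nonneg he
  have hd0 : 0 ≤ 1 - e := sub_nonneg.mpr he1
  have hds : IsSelfAdjoint (1 - e) := .of_nonneg hd0
  have hee : e * e ≤ 1 := by
    simpa [sq] using CStarAlgebra.pow_antitone he he1 (show 0 ≤ 2 by norm_num)
  have hdd : (1 - e) * (1 - e) ≤ 1 - e := by
    simpa [sq] using CStarAlgebra.pow_antitone hd0 (sub_le_self _ he) (show 1 ≤ 2 by norm_num)
  have hw : reTr τ ((1 - e) * (1 - e) * (a * a)) ≤ ‖a‖ * θ := by
    calc reTr τ ((1 - e) * (1 - e) * (a * a)) ≤ reTr τ ((1 - e) * (a * a)) :=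
          reTr_mul_mono hτ hdd has.mul_self_nonneg
      _ = reTr τ (a * (CFC.sqrt a * (1 - e) * CFC.sqrt a)) := by
        rw [reTr_mul_comm hτ a]
        nth_rewrite 1 2 5 [← CFC.sqrt_mul_sqrt_self a ha]
        rw [← mul_assoc, ← mul_assoc, reTr_mul_comm hτ]
        simp only [mul_assoc]
      _ ≤ ‖a‖ * reTr τ (CFC.sqrt a * (1 - e) * CFC.sqrt a) :=
          reTr_mul_le hτ _ (IsSelfAdjoint.of_nonneg (CFC.sqrt_nonneg a) |>.conjugate_nonneg hd0)
      _ = ‖a‖ * reTr τ (a * (1 - e)) := by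
        rw [mul_assoc, reTr_mul_comm hτ, mul_assoc, CFC.sqrt_mul_sqrt_self a ha, reTr_mul_comm hτ]
      _ ≤ ‖a‖ * θ := by gcongr
  have h1 : a - e * a * e = (1 - e) * a + e * a * (1 - e) := by noncomm_ring
  have h2 : reTr τ (star ((1 - e) * a) * ((1 - e) * a)) ≤ ‖a‖ * θ := by
    refine le_trans (le_of_eq ?_) hw
    rw [star_mul, hds.star_eq, has.star_eq, mul_assoc, reTr_mul_comm hτ]
    simp only [mul_assoc]
  have h3 : reTr τ (star (e * a * (1 - e)) * (e * a * (1 - e))) ≤ ‖a‖ * θ := by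
    refine le_trans ?_ hw
    have h4 : star (e * a * (1 - e)) * (e * a * (1 - e)) =
        (1 - e) * (a * (e * e) * a) * (1 - e) := by
      rw [star_mul, star_mul, hds.star_eq, has.star_eq, hes.star_eq]
      simp only [mul_assoc]
    have h5 := hds.conjugate_le_conjugate (has.conjugate_le_conjugate hee)
    rw [mul_one] at h5
    rw [h4]
    refine (reTr_mono hτ h5).trans (le_of_eq ?_)
    rw [reTr_mul_comm hτ]
    simp only [mul_assoc]
  have h6 := reTr_star_mul_self_add_le hτ ((1 - e) * a) (e * a * (1 - e))
  rw [← h1] at h6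
  linarith

lemma HereditaryDense.taoZero [IsSimpleRing A] (H : HereditaryDense A)
    (hT : (traceSet A).Nonempty) {a : A} (ha : 0 ≤ a) : TAOZero a := by
  have : Nonempty ↥(traceSet A) := hT.to_subtype
  intro ε hε
  obtain ⟨θ, hθ0, hθε, hθ⟩ : ∃ θ : ℝ, 0 < θ ∧ θ ≤ ε / 2 ∧ ‖a‖ * θ ≤ ε ^ 2 / 64 := by
    refine ⟨min (ε / 2) (ε ^ 2 / 64 / (‖a‖ + 1)), by positivity, min_le_left _ _, ?_⟩
    calc ‖a‖ * min (ε / 2) (ε ^ 2 / 64 / (‖a‖ + 1))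
        ≤ (‖a‖ + 1) * (ε ^ 2 / 64 / (‖a‖ + 1)) := by
          gcongr
          · linarith
          · exact min_le_right _ _
      _ = ε ^ 2 / 64 := by field_simp
  obtain ⟨e, e', ⟨x, hx⟩, he, he1, he', he'e, h1, h2⟩ := exists_almost_unit H ha hθ0
  have hes : IsSelfAdjoint e := .of_nonneg he
  rcases eq_or_ne a 0 with rfl | ha0
  · refine ⟨0, subset_closure ⟨0, by simp⟩, le_rfl, le_rfl, ?_, ?_⟩
    · refine lt_of_le_of_lt (ciSup_le fun τ => ?_) hε
      simp
    · refine (osc_le hT le_rfl le_rfl zero_le_one le_rfl (mul_zero (0 : A)) one_pos (by simp)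
        (fun τ _ => ?_)).trans_lt (half_lt_self hε)
      simpa using (half_pos hε).le
  have hna : 0 < ‖a‖ := norm_pos_iff.mpr ha0
  set η : ℝ := ε / 8 with hη
  have hη0 : 0 < η := by positivity
  set s : ℝ := ‖a‖ / (‖a‖ + η) with hs
  have hs0 : 0 < s := by positivity
  have hs1 : s ≤ 1 := (div_le_one (by positivity)).mpr (by linarith)
  have hsn : s * (‖a‖ + η) = ‖a‖ := div_mul_cancel₀ _ (by positivity)
  have hen : ‖e‖ ≤ 1 := (CStarAlgebra.norm_le_one_iff_of_nonneg e he).mpr he1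
  have hconj : ∀ y : A, ‖e * y * e‖ ≤ ‖y‖ := fun y => by
    calc ‖e * y * e‖ ≤ ‖e‖ * ‖y‖ * ‖e‖ := norm_mul₃_le
      _ ≤ 1 * ‖y‖ * 1 := by gcongr
      _ = ‖y‖ := by ring
  have hη1 : ‖η • (1 : A)‖ = η := by rw [norm_smul, norm_one, mul_one, Real.norm_of_nonneg hη0.le]
  set c : A := s • (e * (a + η • (1 : A)) * e) with hc
  have hc0 : 0 ≤ c := smul_nonneg hs0.le (hes.conjugate_nonneg
    (add_nonneg ha (smul_nonneg hη0.le zero_le_one)))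
  refine ⟨c, subset_closure ⟨s • (x * a * (a + η • (1 : A)) * a * x), ?_⟩, hc0, ?_, ?_, ?_⟩
  · rw [hc, hx]
    simp only [mul_smul_comm, smul_mul_assoc]
    simp only [mul_assoc]
  · rw [hc, norm_smul, Real.norm_of_nonneg hs0.le]
    calc s * ‖e * (a + η • (1 : A)) * e‖ ≤ s * (‖a‖ + η) := by
          gcongr
          exact (hconj _).trans ((norm_add_le _ _).trans (by rw [hη1]))
      _ = ‖a‖ := hsn
  · have hv : ‖e * a * e - c‖ ≤ 2 * η := by
      have h3 : e * a * e - c = e * ((1 - s) • a - s • η • (1 : A)) * e := by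
        rw [hc]
        simp only [mul_sub, sub_mul, mul_add, add_mul, sub_smul, smul_add, one_smul,
          mul_smul_comm, smul_mul_assoc]
        abel
      rw [h3]
      refine (hconj _).trans ((norm_sub_le _ _).trans ?_)
      rw [norm_smul, norm_smul, hη1, Real.norm_of_nonneg hs0.le,
        Real.norm_of_nonneg (sub_nonneg.mpr hs1)]
      nlinarith
    refine lt_of_le_of_lt (ciSup_le fun τ => ?_) (half_lt_self hε)
    refine Real.sqrt_le_iff.mpr ⟨by positivity, ?_⟩
    rw [← reTr_apply]
    have h3 := reTr_star_mul_self_add_le τ.2 (a - e * a * e) (e * a * e - c)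
    rw [sub_add_sub_cancel] at h3
    have h4 := reTr_star_mul_self_compress_le τ.2 ha he he1 (h2 τ τ.2)
    have h5 := (le_abs_self _).trans (abs_reTr_le τ.2 (star (e * a * e - c) * (e * a * e - c)))
    rw [CStarRing.norm_star_mul_self] at h5
    have h6 := mul_le_mul hv hv (norm_nonneg _) (by positivity)
    rw [hη] at h6
    nlinarith
  · refine (osc_le hT hc0 he he1 he' ?_ (mul_pos hs0 hη0) ?_ h1).trans_lt (by linarith)
    · rw [hc]
      simp only [mul_smul_comm, ← mul_assoc, he'e]
    · rw [hc, mul_add, add_mul, smul_add, mul_smul_comm, smul_mul_assoc, mul_one, smul_smul]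
      exact le_add_of_nonneg_left (smul_nonneg hs0.le (hes.conjugate_nonneg ha))

end Oscillation

/-- Corollary 4.6: if the canonical map is hereditary dense (i.e. condition (1) of
Theorem 4.5 holds for `X₁ = {τ ↦ τ(e) : e ∈ A₊}`), then every positive element of `A` has
tracial approximate oscillation zero. -/
theorem taoZero_of_hereditary_dense [IsSimpleRing A] [PartialOrder A] [StarOrderedRing A]
    (hdim : ¬ FiniteDimensional ℂ A)
    (hT : (traceSet A).Nonempty)
    (X₁ : Set (↥(traceSet A) → ℝ))
    (hX₁ : X₁ = {h | ∃ e : A, 0 ≤ e ∧ h = fun τ : ↥(traceSet A) => ((τ : A →L[ℂ] ℂ) e).re})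
    (H : ∀ a : A, 0 ≤ a → ∀ ε : ℝ, 0 < ε → ∀ f ∈ SigmaX X₁,
      (∀ τ : ↥(traceSet A), f τ < dTau (τ : A →L[ℂ] ℂ) a) →
      ∃ b : A, 0 ≤ b ∧ CuntzLe b a ∧
        ∀ τ : ↥(traceSet A), |f τ - dTau (τ : A →L[ℂ] ℂ) b| < ε) :
    ∀ a : A, 0 ≤ a → TAOZero a := by
  subst hX₁
  refine fun a ha => HereditaryDense.taoZero ?_ hT ha
  intro a ha ε hε e he hlt
  have hmem : (fun τ : ↥(traceSet A) => reTr (τ : A →L[ℂ] ℂ) e) ∈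
      SigmaX {h | ∃ e : A, 0 ≤ e ∧ h = fun τ : ↥(traceSet A) => ((τ : A →L[ℂ] ℂ) e).re} := by
    refine ⟨fun n τ => reTr τ (if n = 0 then e else 0), fun n => ⟨if n = 0 then e else 0, ?_, rfl⟩,
      fun τ => ?_⟩
    · split_ifs
      exacts [he, le_rfl]
    · exact hasSum_single (f := fun n : ℕ => reTr (τ : A →L[ℂ] ℂ) (if n = 0 then e else 0)) 0
        fun n hn => by simp [hn]
  obtain ⟨b, hb, hba, h⟩ := H a ha ε hε _ hmem fun τ => hlt τ τ.2
  exact ⟨b, hb, hba, fun τ hτ => h ⟨τ, hτ⟩⟩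
end

section
/- Let A be a unital simple C*-algebra with T(A) ≠ ∅, let a ∈ A be a nonzero positive element, and let B := Her(a). For x ∈ B define ‖x‖_{2,B} := sup{ τ(x*x)^{1/2} : τ a positive linear functional on A with τ(uv) = τ(vu) for all u, v ∈ A, such that τ(b) ≤ 1 for every positive contraction b ∈ B }. Then there exist constants c₀, c₁ > 0 such that c₀ ‖x‖₂ ≤ ‖x‖_{2,B} ≤ c₁ ‖x‖₂ for all x ∈ B (in particular the supremum defining ‖x‖_{2,B} is finite). -/
open scoped ComplexOrder

variable {A : Type*} [CStarAlgebra A]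

section TracialFunctional

lemma re_map_one_nonneg {τ : A →L[ℂ] ℂ} (hτ : ∀ z : A, 0 ≤ τ (star z * z)) : 0 ≤ (τ 1).re := by
  simpa using (Complex.le_def.mp (hτ 1)).1

lemma bddAbove_norm2_range (x : A) :
    BddAbove (Set.range fun τ : traceSet A ↦ √((τ : A →L[ℂ] ℂ) (star x * x)).re) := by
  refine ⟨√‖star x * x‖, ?_⟩
  rintro _ ⟨⟨τ, -, hn, -⟩, rfl⟩
  refine Real.sqrt_le_sqrt ((Complex.re_le_norm _).trans ?_)
  simpa [hn] using τ.le_opNorm (star x * x)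

variable [PartialOrder A] [StarOrderedRing A]

/-- A positive linear functional on a unital C*-algebra has norm at most its value at `1`. -/
lemma PositiveLinearMap.norm_apply_le_re_map_one_mul (f : A →ₚ[ℂ] ℂ) (z : A) :
    ‖f z‖ ≤ (f 1).re * ‖z‖ := by
  have h1 : (0 : ℂ) ≤ f 1 := f.map_nonneg zero_le_one
  have h1re : ‖f 1‖ = (f 1).re := by
    rw [Complex.eq_re_of_ofReal_le h1, Complex.norm_real, Complex.ofReal_re,
      Real.norm_of_nonneg (Complex.le_def.mp h1).1]
  have hcs := norm_inner_le_norm (𝕜 := ℂ) (f.toPreGNS 1) (f.toPreGNS z)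
  rw [f.preGNS_inner_def, f.preGNS_norm_def, f.preGNS_norm_def] at hcs
  simp only [f.ofPreGNS_toPreGNS, star_one, one_mul] at hcs
  have hz : (f (star z * z)).re ≤ (f 1).re * ‖z‖ ^ 2 := by
    have := f.norm_apply_le_of_nonneg (star z * z) (star_mul_self_nonneg z)
    rw [h1re, CStarRing.norm_star_mul_self, ← sq] at this
    exact (Complex.re_le_norm _).trans this
  have h1' : 0 ≤ (f 1).re := h1re ▸ norm_nonneg _
  calc ‖f z‖ ≤ √(f 1).re * √(f (star z * z)).re := hcs
    _ ≤ √(f 1).re * √((f 1).re * ‖z‖ ^ 2) := by gcongr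
    _ = (f 1).re * ‖z‖ := by
      rw [Real.sqrt_mul h1', Real.sqrt_sq (norm_nonneg z), ← mul_assoc, Real.mul_self_sqrt h1']

/-- A functional that is nonnegative on the elements `star z * z`, as a positive linear map. -/
noncomputable def positiveOfStarMulSelf (τ : A →L[ℂ] ℂ) (hτ : ∀ z : A, 0 ≤ τ (star z * z)) :
    A →ₚ[ℂ] ℂ :=
  PositiveLinearMap.mk₀ (τ : A →ₗ[ℂ] ℂ) fun x hx ↦ by
    obtain ⟨z, rfl⟩ := CStarAlgebra.nonneg_iff_eq_star_mul_self.mp hx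
    exact hτ z

lemma norm_apply_le_re_map_one_mul {τ : A →L[ℂ] ℂ} (hτ : ∀ z : A, 0 ≤ τ (star z * z)) (z : A) :
    ‖τ z‖ ≤ (τ 1).re * ‖z‖ :=
  (positiveOfStarMulSelf τ hτ).norm_apply_le_re_map_one_mul z

lemma norm_eq_re_map_one [Nontrivial A] {τ : A →L[ℂ] ℂ} (hτ : ∀ z : A, 0 ≤ τ (star z * z)) :
    ‖τ‖ = (τ 1).re := by
  refine le_antisymm (τ.opNorm_le_bound (re_map_one_nonneg hτ) (norm_apply_le_re_map_one_mul hτ)) ?_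
  simpa using (Complex.re_le_norm _).trans (τ.le_opNorm 1)

/-- A positive tracial functional is its value at `1` times a tracial state. -/
lemma sqrt_re_apply_le_norm2 [Nontrivial A] {τ : A →L[ℂ] ℂ}
    (hτ : ∀ z : A, 0 ≤ τ (star z * z)) (htr : ∀ u v : A, τ (u * v) = τ (v * u)) (x : A) :
    √(τ (star x * x)).re ≤ √(τ 1).re * norm2 x := by
  have h0 := re_map_one_nonneg hτ
  rcases h0.eq_or_lt with h | h
  · have hz : τ = 0 := by rw [← norm_eq_zero, norm_eq_re_map_one hτ, h]
    simp [hz]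
  · set t := (τ 1).re with ht
    have hmem : ((t⁻¹ : ℝ) : ℂ) • τ ∈ traceSet A := by
      refine ⟨fun z ↦ ?_, ?_, fun u v ↦ by simp [htr u v]⟩
      · exact mul_nonneg (by exact_mod_cast (inv_pos.mpr h).le) (hτ z)
      · rw [norm_smul, norm_eq_re_map_one hτ, ← ht, Complex.norm_real, norm_inv, Real.norm_eq_abs,
          abs_of_pos h, inv_mul_cancel₀ h.ne']
    have hle : √(t⁻¹ * (τ (star x * x)).re) ≤ norm2 x := by
      refine le_trans (le_of_eq ?_) (le_ciSup (bddAbove_norm2_range x) ⟨_, hmem⟩)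
      change _ = √((((t⁻¹ : ℝ) : ℂ) * τ (star x * x)).re)
      rw [Complex.re_ofReal_mul]
    calc √(τ (star x * x)).re = √t * √(t⁻¹ * (τ (star x * x)).re) := by
          rw [← Real.sqrt_mul h0, mul_inv_cancel_left₀ h.ne']
      _ ≤ √t * norm2 x := by gcongr

/-- If `τ` is at most `1` on positive contractions of `Her(a)`, it is at most
`‖a * a‖` at `a * a`. -/
lemma re_apply_mul_self_le {a : A} (ha : 0 ≤ a) {τ : A →L[ℂ] ℂ}
    (hb : ∀ b ∈ her a, 0 ≤ b → ‖b‖ ≤ 1 → (τ b).re ≤ 1) : (τ (a * a)).re ≤ ‖a * a‖ := by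
  have haa : 0 ≤ a * a := by
    simpa [(IsSelfAdjoint.of_nonneg ha).star_eq] using star_mul_self_nonneg a
  rcases (norm_nonneg (a * a)).eq_or_lt with h | h
  · simp [norm_eq_zero.mp h.symm]
  · have := hb (((‖a * a‖⁻¹ : ℝ) : ℂ) • (a * a))
      (subset_closure ⟨((‖a * a‖⁻¹ : ℝ) : ℂ) • 1, by simp⟩)
      (by rw [Complex.coe_smul]; exact smul_nonneg (by positivity) haa)
      (by rw [norm_smul, Complex.norm_real, norm_inv, norm_norm, inv_mul_cancel₀ h.ne'])
    rw [map_smul, smul_eq_mul, Complex.re_ofReal_mul, inv_mul_le_iff₀ h, mul_one] at this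
    exact this

lemma norm_apply_mul_mul_self_le {a : A} (ha : 0 ≤ a) {τ : A →L[ℂ] ℂ}
    (hτ : ∀ z : A, 0 ≤ τ (star z * z)) (htr : ∀ u v : A, τ (u * v) = τ (v * u))
    (hb : ∀ b ∈ her a, 0 ≤ b → ‖b‖ ≤ 1 → (τ b).re ≤ 1) (z : A) :
    ‖τ (z * (a * a))‖ ≤ ‖a * a‖ * ‖z‖ := by
  let σ : A →L[ℂ] ℂ :=
    τ ∘L (ContinuousLinearMap.mul ℂ A).flip a ∘L ContinuousLinearMap.mul ℂ A a
  have hσ (w : A) : σ w = τ (a * w * a) := rfl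
  have hpos (w : A) : 0 ≤ σ (star w * w) := by
    have := hτ (w * a)
    rwa [star_mul, (IsSelfAdjoint.of_nonneg ha).star_eq, ← mul_assoc, mul_assoc a,
      ← hσ] at this
  have h := norm_apply_le_re_map_one_mul hpos z
  rw [hσ, hσ, mul_one, mul_assoc, htr, mul_assoc] at h
  exact h.trans (by gcongr; exact re_apply_mul_self_le ha hb)

/-- In a simple unital C*-algebra, the tracial positive functionals that are at most `1` on
positive contractions of `Her(a)` are uniformly bounded at `1`. -/
lemma exists_re_map_one_le [IsSimpleRing A] {a : A} (ha : 0 ≤ a) (ha0 : a ≠ 0) :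
    ∃ C : ℝ, ∀ τ : A →L[ℂ] ℂ, (∀ z : A, 0 ≤ τ (star z * z)) →
      (∀ u v : A, τ (u * v) = τ (v * u)) →
      (∀ b ∈ her a, 0 ≤ b → ‖b‖ ≤ 1 → (τ b).re ≤ 1) → (τ 1).re ≤ C := by
  have haa : a * a ≠ 0 := by
    intro h
    refine ha0 (CStarRing.star_mul_self_eq_zero_iff a |>.mp ?_)
    rwa [(IsSelfAdjoint.of_nonneg ha).star_eq]
  have htop : (1 : A) ∈ TwoSidedIdeal.span {a * a} := by
    have hne : TwoSidedIdeal.span {a * a} ≠ ⊥ := by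
      intro h
      have : a * a ∈ TwoSidedIdeal.span {a * a} := TwoSidedIdeal.subset_span rfl
      rw [h] at this
      exact haa this
    rw [(eq_bot_or_eq_top _).resolve_left hne]
    trivial
  suffices ∀ w ∈ TwoSidedIdeal.span {a * a}, ∃ C : ℝ, 0 ≤ C ∧ ∀ τ : A →L[ℂ] ℂ, (∀ z : A, 0 ≤ τ (star z * z)) →
      (∀ u v : A, τ (u * v) = τ (v * u)) →
      (∀ b ∈ her a, 0 ≤ b → ‖b‖ ≤ 1 → (τ b).re ≤ 1) → ∀ z, ‖τ (z * w)‖ ≤ C * ‖z‖ by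
    obtain ⟨C, -, hC⟩ := this 1 htop
    refine ⟨C, fun τ h₁ h₂ h₃ ↦ (Complex.re_le_norm _).trans ?_⟩
    simpa using hC τ h₁ h₂ h₃ 1
  intro w hw
  induction hw using TwoSidedIdeal.span_induction with
  | mem u hu =>
    obtain rfl : u = a * a := hu
    exact ⟨‖a * a‖, norm_nonneg _, fun τ h₁ h₂ h₃ z ↦ norm_apply_mul_mul_self_le ha h₁ h₂ h₃ z⟩
  | zero => exact ⟨0, le_rfl, by simp⟩
  | add u v _ _ hu hv =>
    obtain ⟨C, hC, hu⟩ := hu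
    obtain ⟨D, hD, hv⟩ := hv
    refine ⟨C + D, by positivity, fun τ h₁ h₂ h₃ z ↦ ?_⟩
    rw [mul_add, map_add, add_mul]
    exact (norm_add_le _ _).trans (add_le_add (hu τ h₁ h₂ h₃ z) (hv τ h₁ h₂ h₃ z))
  | neg u _ hu =>
    obtain ⟨C, hC, hu⟩ := hu
    exact ⟨C, hC, fun τ h₁ h₂ h₃ z ↦ by simpa using hu τ h₁ h₂ h₃ z⟩
  | left_absorb w u _ hu =>
    obtain ⟨C, hC, hu⟩ := hu
    refine ⟨C * ‖w‖, by positivity, fun τ h₁ h₂ h₃ z ↦ ?_⟩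
    rw [← mul_assoc]
    refine (hu τ h₁ h₂ h₃ _).trans ?_
    rw [mul_assoc, mul_comm ‖w‖]
    gcongr
    exact norm_mul_le _ _
  | right_absorb w u _ hu =>
    obtain ⟨C, hC, hu⟩ := hu
    refine ⟨C * ‖w‖, by positivity, fun τ h₁ h₂ h₃ z ↦ ?_⟩
    rw [← mul_assoc, h₂, ← mul_assoc]
    refine (hu τ h₁ h₂ h₃ _).trans ?_
    rw [mul_assoc]
    gcongr
    exact norm_mul_le _ _

end TracialFunctional

/-- Lemma 7.9(2): comparison of the tracial 2-seminorm of `A` with the 2-seminorm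
`‖x‖_{2,B} = sup { τ(x*x)^{1/2} }` of the hereditary subalgebra `B = Her(a)`, where the
supremum runs over the tracial positive functionals on `A` which are at most `1` on positive
contractions of `B`.  There are constants `c₀, c₁ > 0` with
`c₀ ‖x‖₂ ≤ ‖x‖_{2,B} ≤ c₁ ‖x‖₂` for all `x ∈ B`; in particular the supremum is finite. -/
theorem norm2_hereditary_comparison [IsSimpleRing A] [PartialOrder A] [StarOrderedRing A]
    (hT : (traceSet A).Nonempty) (a : A) (ha : 0 ≤ a) (ha0 : a ≠ 0) :
    ∃ c₀ : ℝ, 0 < c₀ ∧ ∃ c₁ : ℝ, 0 < c₁ ∧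
      ∀ x ∈ her a, ∀ S : Set ℝ,
        S = {r : ℝ | ∃ τ : A →L[ℂ] ℂ,
          (∀ z : A, 0 ≤ τ (star z * z)) ∧
          (∀ u v : A, τ (u * v) = τ (v * u)) ∧
          (∀ b ∈ her a, 0 ≤ b → ‖b‖ ≤ 1 → (τ b).re ≤ 1) ∧
          r = Real.sqrt ((τ (star x * x)).re)} →
        BddAbove S ∧ c₀ * norm2 x ≤ sSup S ∧ sSup S ≤ c₁ * norm2 x := by
  have : Nontrivial A := ⟨a, 0, ha0⟩
  obtain ⟨C, hC⟩ := exists_re_map_one_le ha ha0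
  have : Nonempty (traceSet A) := hT.to_subtype
  refine ⟨1, one_pos, √C + 1, by positivity, ?_⟩
  rintro x - S rfl
  have hnn : 0 ≤ norm2 x := Real.iSup_nonneg fun _ ↦ Real.sqrt_nonneg _
  have hmem (τ : traceSet A) (b : A) (hb : ‖b‖ ≤ 1) : ((τ : A →L[ℂ] ℂ) b).re ≤ 1 := by
    refine (Complex.re_le_norm _).trans ((τ.1.le_opNorm b).trans ?_)
    rwa [τ.2.2.1, one_mul]
  have hbound : ∀ r ∈ {r : ℝ | ∃ τ : A →L[ℂ] ℂ,
      (∀ z : A, 0 ≤ τ (star z * z)) ∧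
      (∀ u v : A, τ (u * v) = τ (v * u)) ∧
      (∀ b ∈ her a, 0 ≤ b → ‖b‖ ≤ 1 → (τ b).re ≤ 1) ∧
      r = Real.sqrt ((τ (star x * x)).re)}, r ≤ (√C + 1) * norm2 x := by
    rintro _ ⟨τ, h₁, h₂, h₃, rfl⟩
    refine (sqrt_re_apply_le_norm2 h₁ h₂ x).trans ?_
    gcongr
    exact (Real.sqrt_le_sqrt (hC τ h₁ h₂ h₃)).trans (by linarith)
  refine ⟨⟨_, hbound⟩, ?_, Real.sSup_le hbound (by positivity)⟩
  rw [one_mul]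
  exact ciSup_le fun τ ↦ le_csSup ⟨_, hbound⟩
    ⟨τ, τ.2.1, τ.2.2.2, fun b _ _ hb ↦ hmem τ b hb, rfl⟩
end
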